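/- For μ > 0 and x > 0, Q_μ(x,y) as a function of y satisfies ∂²Q_μ(x,y)/∂x² < 0 whenever x > y − μ − 1/2, and ∂²Q_μ(x,y)/∂x² > 0 whenever 0 < x < y − μ − 1. -/

import Mathlib

open Real MeasureTheory Set Filter

/-- Modified Bessel function of the first kind `I_ν(z)` (for positive real argument),
defined by its Maclaurin-type series. -/
noncomputable def besselI (ν z : ℝ) : ℝ :=
  ∑' n : ℕ, (z / 2) ^ (ν + 2 * (n : ℝ)) / ((Nat.factorial n : ℝ) * Real.Gamma (ν + (n : ℝ) + 1))

/-- Generalized Marcum Q-function. -/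
noncomputable def marcumQ (μ x y : ℝ) : ℝ :=
  x ^ ((1 - μ) / 2) *
    ∫ t in Set.Ioi y, t ^ ((μ - 1) / 2) * Real.exp (-t - x) * besselI (μ - 1) (2 * Real.sqrt (x * t))

/-- Complementary generalized Marcum P-function. -/
noncomputable def marcumP (μ x y : ℝ) : ℝ :=
  x ^ ((1 - μ) / 2) *
    ∫ t in Set.Ioc (0 : ℝ) y, t ^ ((μ - 1) / 2) * Real.exp (-t - x) * besselI (μ - 1) (2 * Real.sqrt (x * t))

/-- The entire function `F_ν(z) = ∑ z^n / (n! Γ(ν+n+1))`. -/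
noncomputable def cF (ν z : ℝ) : ℝ :=
  ∑' n : ℕ, z ^ n / ((Nat.factorial n : ℝ) * Real.Gamma (ν + (n : ℝ) + 1))

lemma gam_pos {ν : ℝ} (hν : -1 < ν) (n : ℕ) : 0 < Real.Gamma (ν + (n : ℝ) + 1) := by
  apply Real.Gamma_pos_of_pos
  have : (0 : ℝ) ≤ n := Nat.cast_nonneg n
  linarith

lemma gam_bound {ν : ℝ} (hν : -1 < ν) {K : ℝ} (hK : 0 < K) :
    ∃ C : ℝ, 0 < C ∧ ∀ n : ℕ, K ^ n / Real.Gamma (ν + (n : ℝ) + 1) ≤ C := by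
  have hs : Summable (fun n : ℕ => K ^ n / Real.Gamma (ν + (n : ℝ) + 1)) := by
    apply summable_of_ratio_test_tendsto_lt_one (l := 0) zero_lt_one
    · exact Eventually.of_forall fun n => (div_pos (pow_pos hK n) (gam_pos hν n)).ne'
    · have h1 : ∀ n : ℕ, ‖K ^ (n+1) / Real.Gamma (ν + ((n+1 : ℕ) : ℝ) + 1)‖ /
          ‖K ^ n / Real.Gamma (ν + (n : ℝ) + 1)‖ = K / (ν + (n : ℝ) + 1) := by
        intro n
        have hp := gam_pos hν n
        have hp' := gam_pos hν (n+1)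
        have hn : (0 : ℝ) ≤ n := Nat.cast_nonneg n
        have hq : 0 < ν + (n : ℝ) + 1 := by linarith
        rw [Real.norm_of_nonneg (div_pos (pow_pos hK _) hp').le,
          Real.norm_of_nonneg (div_pos (pow_pos hK _) hp).le]
        have : Real.Gamma (ν + ((n+1 : ℕ) : ℝ) + 1)
            = (ν + (n : ℝ) + 1) * Real.Gamma (ν + (n : ℝ) + 1) := by
          rw [← Real.Gamma_add_one hq.ne']
          push_cast
          ring_nf
        rw [this, pow_succ]
        field_simp
      simp_rw [h1]
      apply Tendsto.div_atTop tendsto_const_nhds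
      apply tendsto_atTop_add_const_right
      exact tendsto_atTop_add_const_left _ _ tendsto_natCast_atTop_atTop
  have hpos : ∀ n : ℕ, 0 < K ^ n / Real.Gamma (ν + (n : ℝ) + 1) :=
    fun n => div_pos (pow_pos hK n) (gam_pos hν n)
  refine ⟨∑' n : ℕ, K ^ n / Real.Gamma (ν + (n : ℝ) + 1), hs.tsum_pos (fun n => (hpos n).le) 0 (hpos 0), ?_⟩
  intro n
  exact hs.le_tsum n (fun j _ => (hpos j).le)

lemma cF_summable {ν : ℝ} (hν : -1 < ν) (z : ℝ) :
    Summable (fun n : ℕ => z ^ n / ((Nat.factorial n : ℝ) * Real.Gamma (ν + (n : ℝ) + 1))) := by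
  obtain ⟨C, hC, h⟩ := gam_bound hν zero_lt_one
  refine Summable.of_norm_bounded (g := fun n : ℕ => C * (|z| ^ n / (Nat.factorial n : ℝ))) ?_ ?_
  · exact (Real.summable_pow_div_factorial |z|).mul_left C
  · intro n
    have hp := gam_pos hν n
    have hf : (0 : ℝ) < Nat.factorial n := by positivity
    rw [norm_div, norm_pow, Real.norm_eq_abs, Real.norm_of_nonneg (mul_pos hf hp).le]
    have h2 := h n
    rw [one_pow] at h2
    calc |z| ^ n / ((Nat.factorial n : ℝ) * Real.Gamma (ν + (n : ℝ) + 1))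
        = (1 / Real.Gamma (ν + (n : ℝ) + 1)) * (|z| ^ n / (Nat.factorial n : ℝ)) := by
          field_simp
      _ ≤ _ := by gcongr

lemma cF_pos {ν : ℝ} (hν : -1 < ν) {z : ℝ} (hz : 0 ≤ z) : 0 < cF ν z := by
  refine (cF_summable hν z).tsum_pos (fun n => ?_) 0 ?_
  · have hp := gam_pos hν n
    positivity
  · have hp := gam_pos hν 0
    positivity

lemma cF_mono {ν : ℝ} (hν : -1 < ν) {z w : ℝ} (hz : 0 ≤ z) (hw : z ≤ w) : cF ν z ≤ cF ν w := by
  refine (cF_summable hν z).tsum_le_tsum (fun n => ?_) (cF_summable hν w)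
  have hp := gam_pos hν n
  gcongr

lemma cF_bound {ν : ℝ} (hν : -1 < ν) {X : ℝ} (hX : 0 < X) :
    ∃ C : ℝ, 0 < C ∧ ∀ t : ℝ, 0 ≤ t → cF ν (X * t) ≤ C * Real.exp (t / 2) := by
  obtain ⟨C, hC, h⟩ := gam_bound hν (K := 2 * X) (by positivity)
  refine ⟨C, hC, fun t ht => ?_⟩
  have hE : HasSum (fun n : ℕ => (t / 2) ^ n / (Nat.factorial n : ℝ)) (Real.exp (t / 2)) := by
    rw [Real.exp_eq_exp_ℝ]
    exact NormedSpace.expSeries_div_hasSum_exp (t / 2)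
  refine hasSum_le (fun n => ?_) (cF_summable hν (X * t)).hasSum (hE.mul_left C)
  have hp := gam_pos hν n
  have h2 := h n
  calc (X * t) ^ n / ((Nat.factorial n : ℝ) * Real.Gamma (ν + (n : ℝ) + 1))
      = ((2 * X) ^ n / Real.Gamma (ν + (n : ℝ) + 1)) * ((t / 2) ^ n / (Nat.factorial n : ℝ)) := by
        rw [show X * t = (2 * X) * (t / 2) by ring, mul_pow (2 * X) (t / 2)]
        field_simp
    _ ≤ _ := by gcongr

lemma shift_term (ν z : ℝ) (n : ℕ) :
    ((n+1 : ℕ) : ℝ) * z ^ n / ((Nat.factorial (n+1) : ℝ) * Real.Gamma (ν + ((n+1 : ℕ) : ℝ) + 1))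
      = z ^ n / ((Nat.factorial n : ℝ) * Real.Gamma (ν + 1 + (n : ℝ) + 1)) := by
  rw [Nat.factorial_succ, show ν + ((n+1 : ℕ) : ℝ) + 1 = ν + 1 + (n : ℝ) + 1 by push_cast; ring]
  have : ((n + 1 : ℕ) : ℝ) ≠ 0 := by positivity
  push_cast at this ⊢
  rw [mul_assoc, mul_div_mul_left _ _ this]

lemma cF_hasDerivAt {ν : ℝ} (hν : -1 < ν) (z : ℝ) : HasDerivAt (cF ν) (cF (ν + 1) z) z := by
  have hν' : -1 < ν + 1 := by linarith
  set R := |z| + 1 with hR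
  have hR0 : 0 < R := by positivity
  have key : ∀ w : ℝ, HasSum (fun n : ℕ => (n : ℝ) * w ^ (n - 1) /
      ((Nat.factorial n : ℝ) * Real.Gamma (ν + (n : ℝ) + 1))) (cF (ν + 1) w) := by
    intro w
    rw [← hasSum_nat_add_iff' 1]
    simp only [Finset.sum_range_one, Nat.cast_zero, zero_mul, zero_div, sub_zero, Nat.add_sub_cancel]
    simp_rw [shift_term]
    exact (cF_summable hν' w).hasSum
  rw [← (key z).tsum_eq]
  refine hasDerivAt_tsum_of_isPreconnected (t := Metric.ball (0 : ℝ) R) (y₀ := 0) (key R).summable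
    Metric.isOpen_ball (convex_ball _ _).isPreconnected (g := fun (n : ℕ) (z : ℝ) => z ^ n / ((Nat.factorial n : ℝ) * Real.Gamma (ν + (n : ℝ) + 1)))
    (g' := fun (n : ℕ) (w : ℝ) => (n : ℝ) * w ^ (n - 1) /
      ((Nat.factorial n : ℝ) * Real.Gamma (ν + (n : ℝ) + 1))) ?_ ?_ ?_ (cF_summable hν 0) ?_
  · intro n w _
    exact (hasDerivAt_pow n w).div_const _
  · intro n w hw
    have hp := gam_pos hν n
    have hw' : |w| ≤ R := by simpa using (mem_ball_zero_iff.mp hw).le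
    rw [norm_div, norm_mul, norm_pow, Real.norm_eq_abs w, Real.norm_of_nonneg (by positivity : (0:ℝ) ≤ n),
      Real.norm_of_nonneg (by positivity : (0:ℝ) ≤ (Nat.factorial n : ℝ) * Real.Gamma (ν + (n : ℝ) + 1))]
    gcongr
  · simpa using hR0
  · simp [hR]

lemma cF_continuous {ν : ℝ} (hν : -1 < ν) : Continuous (cF ν) :=
  continuous_iff_continuousAt.mpr fun z => (cF_hasDerivAt hν z).continuousAt

lemma cF_rec {ν : ℝ} (hν : -1 < ν) (z : ℝ) :
    cF ν z = (ν + 1) * cF (ν + 1) z + z * cF (ν + 1 + 1) z := by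
  have hν' : -1 < ν + 1 := by linarith
  have hν'' : -1 < ν + 1 + 1 := by linarith
  have key : HasSum (fun n : ℕ => (n : ℝ) * z ^ n /
      ((Nat.factorial n : ℝ) * Real.Gamma (ν + 1 + (n : ℝ) + 1))) (z * cF (ν + 1 + 1) z) := by
    rw [← hasSum_nat_add_iff' 1]
    simp only [Finset.sum_range_one, Nat.cast_zero, zero_mul, zero_div, sub_zero]
    refine ((cF_summable hν'' z).hasSum.mul_left z).congr_fun ?_
    intro n
    rw [← shift_term, pow_succ]
    ring
  have h2 := ((cF_summable hν' z).hasSum.mul_left (ν + 1)).add key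
  refine HasSum.tsum_eq (h2.congr_fun ?_)
  intro n
  have hp := gam_pos hν n
  have hn : (0 : ℝ) ≤ n := Nat.cast_nonneg n
  have hq : 0 < ν + (n : ℝ) + 1 := by linarith
  have e : Real.Gamma (ν + 1 + (n : ℝ) + 1) = (ν + (n : ℝ) + 1) * Real.Gamma (ν + (n : ℝ) + 1) := by
    rw [← Real.Gamma_add_one hq.ne']
    ring_nf
  rw [e]
  field_simp
  ring

lemma cF_upper {μ : ℝ} (hμ : 0 < μ) {z : ℝ} (hz : 0 < z) :
    0 < cF μ z ^ 2 - (μ + 1/2) * cF μ z * cF (μ + 1) z - z * cF (μ + 1) z ^ 2 := by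
  have h0 : -1 < μ := by linarith
  have h1 : -1 < μ + 1 := by linarith
  set H : ℝ → ℝ := fun z => z ^ (μ + 1/2) *
    (cF μ z ^ 2 - (μ + 1/2) * cF μ z * cF (μ + 1) z - z * cF (μ + 1) z ^ 2) with hH
  have hmono : StrictMonoOn H (Ici 0) := by
    apply strictMonoOn_of_deriv_pos (convex_Ici 0)
    · apply Continuous.continuousOn
      have c0 := cF_continuous h0
      have c1 := cF_continuous h1
      have c2 : Continuous (fun z : ℝ => z ^ (μ + 1/2)) := Real.continuous_rpow_const (by linarith)
      fun_prop
    · intro w hw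
      rw [interior_Ici] at hw
      have hw : 0 < w := hw
      have d0 := cF_hasDerivAt h0 w
      have d1 := cF_hasDerivAt h1 w
      have dp := Real.hasDerivAt_rpow_const (x := w) (p := μ + 1/2) (Or.inl hw.ne')
      have hd := dp.mul (((d0.pow 2).sub ((d0.const_mul (μ + 1/2)).mul d1)).sub ((hasDerivAt_id w).mul (d1.pow 2)))
      have hd' : HasDerivAt H _ w := hd
      rw [hd'.deriv]
      have r := cF_rec h0 w
      have p0 := cF_pos h0 hw.le
      have p1 := cF_pos h1 hw.le
      have pw : 0 < w ^ (μ + 1/2 - 1) := Real.rpow_pos_of_pos hw _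
      have e : w ^ (μ + 1/2) = w ^ (μ + 1/2 - 1) * w := by
        rw [Real.rpow_sub_one hw.ne']; field_simp
      rw [e]
      have : 0 < w ^ (μ + 1/2 - 1) * ((μ + 1/2) / 2 * (cF μ w * cF (μ + 1) w)) := by positivity
      refine this.trans_eq ?_
      simp only [Pi.sub_apply, Pi.mul_apply, Pi.pow_apply, id]
      generalize w ^ (μ + 1/2 - 1) = P
      generalize cF μ w = A at *
      generalize cF (μ + 1) w = B at *
      generalize cF (μ + 1 + 1) w = D at *
      subst r
      push_cast
      ring
  have := hmono (mem_Ici.mpr le_rfl) (mem_Ici.mpr hz.le) hz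
  simp only [hH] at this
  rw [Real.zero_rpow (by linarith), zero_mul] at this
  exact (mul_pos_iff_of_pos_left (Real.rpow_pos_of_pos hz _)).mp this

lemma cF_lower {μ : ℝ} (hμ : 0 < μ) {z : ℝ} (hz : 0 < z) :
    0 < (μ + 1) * cF μ z * cF (μ + 1) z + z * cF (μ + 1) z ^ 2 - cF μ z ^ 2 := by
  have h0 : -1 < μ := by linarith
  have h1 : -1 < μ + 1 := by linarith
  set H : ℝ → ℝ := fun z => z ^ (μ + 1) *
    ((μ + 1) * cF μ z * cF (μ + 1) z + z * cF (μ + 1) z ^ 2 - cF μ z ^ 2) with hH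
  have hmono : StrictMonoOn H (Ici 0) := by
    apply strictMonoOn_of_deriv_pos (convex_Ici 0)
    · apply Continuous.continuousOn
      have c0 := cF_continuous h0
      have c1 := cF_continuous h1
      have c2 : Continuous (fun z : ℝ => z ^ (μ + 1)) := Real.continuous_rpow_const (by linarith)
      fun_prop
    · intro w hw
      rw [interior_Ici] at hw
      have hw : 0 < w := hw
      have d0 := cF_hasDerivAt h0 w
      have d1 := cF_hasDerivAt h1 w
      have dp := Real.hasDerivAt_rpow_const (x := w) (p := μ + 1) (Or.inl hw.ne')
      have hd := dp.mul ((((d0.const_mul (μ + 1)).mul d1).add ((hasDerivAt_id w).mul (d1.pow 2))).sub (d0.pow 2))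
      have hd' : HasDerivAt H _ w := hd
      rw [hd'.deriv]
      have r := cF_rec h0 w
      have p1 := cF_pos h1 hw.le
      have pw : 0 < w ^ (μ + 1 - 1) := Real.rpow_pos_of_pos hw _
      have e : w ^ (μ + 1) = w ^ (μ + 1 - 1) * w := by
        rw [Real.rpow_sub_one hw.ne']; field_simp
      rw [e]
      have : 0 < w ^ (μ + 1 - 1) * (w * cF (μ + 1) w ^ 2) := by positivity
      refine this.trans_eq ?_
      simp only [Pi.sub_apply, Pi.add_apply, Pi.mul_apply, Pi.pow_apply, id]
      generalize w ^ (μ + 1 - 1) = P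
      generalize cF μ w = A at *
      generalize cF (μ + 1) w = B at *
      generalize cF (μ + 1 + 1) w = D at *
      subst r
      push_cast
      ring
  have := hmono (mem_Ici.mpr le_rfl) (mem_Ici.mpr hz.le) hz
  simp only [hH] at this
  rw [Real.zero_rpow (by linarith), zero_mul] at this
  exact (mul_pos_iff_of_pos_left (Real.rpow_pos_of_pos hz _)).mp this

lemma bessel_eq {ν x t : ℝ} (hx : 0 < x) (ht : 0 < t) :
    besselI ν (2 * Real.sqrt (x * t)) = x ^ (ν / 2) * t ^ (ν / 2) * cF ν (x * t) := by
  unfold besselI cF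
  rw [← tsum_mul_left]
  congr 1
  ext n
  have hxt : 0 < x * t := mul_pos hx ht
  rw [mul_div_cancel_left₀ _ (two_ne_zero), Real.sqrt_eq_rpow, ← Real.rpow_mul hxt.le,
    show 1 / 2 * (ν + 2 * (n : ℝ)) = ν / 2 + n by ring, Real.rpow_add hxt, Real.rpow_natCast,
    Real.mul_rpow hx.le ht.le, mul_div_assoc]

lemma marcumQ_eq {μ x y : ℝ} (hx : 0 < x) (hy : 0 < y) :
    marcumQ μ x y = Real.exp (-x) *
      ∫ t in Set.Ioi y, t ^ (μ - 1) * Real.exp (-t) * cF (μ - 1) (x * t) := by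
  unfold marcumQ
  rw [← integral_const_mul, ← integral_const_mul]
  refine setIntegral_congr_fun measurableSet_Ioi ?_
  intro t ht
  have ht : 0 < t := hy.trans ht
  simp only
  rw [bessel_eq hx ht, sub_eq_add_neg (-t) x, Real.exp_add]
  have e1 : x ^ ((1 - μ) / 2) * x ^ ((μ - 1) / 2) = 1 := by
    rw [← Real.rpow_add hx, show (1 - μ) / 2 + (μ - 1) / 2 = 0 by ring, Real.rpow_zero]
  have e2 : t ^ ((μ - 1) / 2) * t ^ ((μ - 1) / 2) = t ^ (μ - 1) := by
    rw [← Real.rpow_add ht]; ring_nf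
  rw [← e2]
  linear_combination (t ^ ((μ - 1) / 2) * t ^ ((μ - 1) / 2) * Real.exp (-t) * Real.exp (-x) * cF (μ - 1) (x * t)) * e1

lemma aesm {ν : ℝ} (hν : -1 < ν) (s x : ℝ) {y : ℝ} (hy : 0 < y) :
    AEStronglyMeasurable (fun t : ℝ => t ^ s * Real.exp (-t) * cF ν (x * t))
      (volume.restrict (Ioi y)) := by
  refine ContinuousOn.aestronglyMeasurable ?_ measurableSet_Ioi
  have c := cF_continuous hν
  have c1 : ContinuousOn (fun t : ℝ => t ^ s) (Ioi y) := fun t ht =>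
    (Real.continuousAt_rpow_const t s (Or.inl (hy.trans ht).ne')).continuousWithinAt
  have c2 : Continuous (fun t : ℝ => Real.exp (-t)) := by fun_prop
  have c3 : Continuous (fun t : ℝ => cF ν (x * t)) := by fun_prop
  exact (c1.mul c2.continuousOn).mul c3.continuousOn

lemma integ {ν : ℝ} (hν : -1 < ν) {s x y : ℝ} (hs : -1 < s) (hx : 0 < x) (hy : 0 < y) :
    Integrable (fun t : ℝ => t ^ s * Real.exp (-t) * cF ν (x * t)) (volume.restrict (Ioi y)) := by
  obtain ⟨C, hC, h⟩ := cF_bound hν hx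
  have hi := integrableOn_rpow_mul_exp_neg_mul_rpow (p := 1) (s := s) (b := 1/2) hs one_pos (by norm_num)
  have hi2 := ((hi.mono_set (Ioi_subset_Ioi hy.le)).const_mul C)
  refine Integrable.mono' hi2 (aesm hν s x hy) ?_
  refine (ae_restrict_mem measurableSet_Ioi).mono fun t ht => ?_
  have ht : 0 < t := hy.trans ht
  have hp := cF_pos hν (mul_pos hx ht).le
  rw [Real.norm_of_nonneg (by positivity), Real.rpow_one]
  calc t ^ s * Real.exp (-t) * cF ν (x * t) ≤ t ^ s * Real.exp (-t) * (C * Real.exp (t / 2)) := by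
        gcongr
        exact h t ht.le
    _ = C * (t ^ s * (Real.exp (-t) * Real.exp (t / 2))) := by ring
    _ = _ := by rw [← Real.exp_add]; ring_nf

lemma deriv_int {μ x y : ℝ} (hμ : 0 < μ) (hx : 0 < x) (hy : 0 < y) :
    HasDerivAt (fun x => ∫ t in Set.Ioi y, t ^ (μ - 1) * Real.exp (-t) * cF (μ - 1) (x * t))
      (∫ t in Set.Ioi y, t ^ μ * Real.exp (-t) * cF μ (x * t)) x := by
  have h0 : -1 < μ := by linarith
  have hm : -1 < μ - 1 := by linarith
  refine (hasDerivAt_integral_of_dominated_loc_of_deriv_le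
    (s := Ioo 0 (x + 1)) (F := fun x t => t ^ (μ - 1) * Real.exp (-t) * cF (μ - 1) (x * t))
    (F' := fun x t => t ^ μ * Real.exp (-t) * cF μ (x * t))
    (bound := fun t => t ^ μ * Real.exp (-t) * cF μ ((x + 1) * t))
    (Ioo_mem_nhds hx (by linarith)) ?_ (integ hm hm hx hy) (aesm h0 _ _ hy) ?_
    (integ h0 h0 (by linarith) hy) ?_).2
  · exact Eventually.of_forall fun x => aesm hm _ _ hy
  · refine (ae_restrict_mem measurableSet_Ioi).mono fun t ht w hw => ?_
    have ht : 0 < t := hy.trans ht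
    have hp := cF_pos h0 (mul_pos hw.1 ht).le
    rw [Real.norm_of_nonneg (by positivity)]
    gcongr
    exact cF_mono h0 (mul_pos hw.1 ht).le (by gcongr; exact hw.2.le)
  · refine (ae_restrict_mem measurableSet_Ioi).mono fun t ht w hw => ?_
    have ht : 0 < t := hy.trans ht
    have hd := (cF_hasDerivAt hm (w * t)).comp w ((hasDerivAt_id w).mul_const t)
    have hd2 := hd.const_mul (t ^ (μ - 1) * Real.exp (-t))
    rw [sub_add_cancel] at hd2
    refine hd2.congr_deriv ?_
    rw [Real.rpow_sub_one ht.ne']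
    field_simp

lemma int_diff {μ x y : ℝ} (hμ : 0 < μ) (hx : 0 < x) (hy : 0 < y) :
    (∫ t in Set.Ioi y, t ^ μ * Real.exp (-t) * cF μ (x * t)) -
      (∫ t in Set.Ioi y, t ^ (μ - 1) * Real.exp (-t) * cF (μ - 1) (x * t))
      = y ^ μ * Real.exp (-y) * cF μ (x * y) := by
  have h0 : -1 < μ := by linarith
  have hm : -1 < μ - 1 := by linarith
  rw [← integral_sub (integ h0 h0 hx hy) (integ hm hm hx hy)]
  have hlim : Tendsto (fun t => -(t ^ μ * Real.exp (-t) * cF μ (x * t))) atTop (nhds 0) := by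
    rw [← neg_zero]
    apply Tendsto.neg
    obtain ⟨C, hC, h⟩ := cF_bound h0 hx
    have hl := (tendsto_rpow_mul_exp_neg_mul_atTop_nhds_zero μ (1/2) (by norm_num)).const_mul C
    rw [mul_zero] at hl
    refine tendsto_of_tendsto_of_tendsto_of_le_of_le' tendsto_const_nhds hl ?_ ?_
    · filter_upwards [eventually_gt_atTop 0] with t ht
      have hp := cF_pos h0 (mul_pos hx ht).le
      positivity
    · filter_upwards [eventually_gt_atTop 0] with t ht
      calc t ^ μ * Real.exp (-t) * cF μ (x * t) ≤ t ^ μ * Real.exp (-t) * (C * Real.exp (t / 2)) := by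
            gcongr
            exact h t ht.le
        _ = C * (t ^ μ * (Real.exp (-t) * Real.exp (t / 2))) := by ring
        _ = _ := by rw [← Real.exp_add]; ring_nf
  have hderiv : ∀ t ∈ Ici y, HasDerivAt (fun t => -(t ^ μ * Real.exp (-t) * cF μ (x * t)))
      (t ^ μ * Real.exp (-t) * cF μ (x * t) - t ^ (μ - 1) * Real.exp (-t) * cF (μ - 1) (x * t)) t := by
    intro t ht
    have ht : 0 < t := hy.trans_le ht
    have hd := (cF_hasDerivAt h0 (x * t)).comp t ((hasDerivAt_id t).const_mul x)
    have dp := Real.hasDerivAt_rpow_const (x := t) (p := μ) (Or.inl ht.ne')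
    have de := (hasDerivAt_neg t).exp
    refine ((dp.mul de).mul hd).neg.congr_deriv ?_
    have r := cF_rec hm (x * t)
    rw [sub_add_cancel] at r
    have e : t ^ μ = t ^ (μ - 1) * t := by rw [Real.rpow_sub_one ht.ne']; field_simp
    simp only [Pi.mul_apply, Function.comp]
    rw [r, e]
    ring
  rw [integral_Ioi_of_hasDerivAt_of_tendsto' hderiv ((integ h0 h0 hx hy).sub (integ hm hm hx hy)) hlim]
  ring

lemma deriv1 {μ x y : ℝ} (hμ : 0 < μ) (hx : 0 < x) (hy : 0 < y) :
    deriv (fun x' => marcumQ μ x' y) x = Real.exp (-x) * (y ^ μ * Real.exp (-y) * cF μ (x * y)) := by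
  have he : (fun x' => marcumQ μ x' y) =ᶠ[nhds x] fun x' => Real.exp (-x') *
      ∫ t in Set.Ioi y, t ^ (μ - 1) * Real.exp (-t) * cF (μ - 1) (x' * t) := by
    filter_upwards [Ioi_mem_nhds hx] with w hw
    exact marcumQ_eq hw hy
  rw [he.deriv_eq, ← int_diff hμ hx hy]
  refine ((hasDerivAt_neg x).exp.mul (deriv_int hμ hx hy)).deriv.trans ?_
  ring

lemma deriv2 {μ x y : ℝ} (hμ : 0 < μ) (hx : 0 < x) (hy : 0 < y) :
    deriv (deriv (fun x' => marcumQ μ x' y)) x =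
      (Real.exp (-x) * (y ^ μ * Real.exp (-y))) * (y * cF (μ + 1) (x * y) - cF μ (x * y)) := by
  have he : deriv (fun x' => marcumQ μ x' y) =ᶠ[nhds x] fun x' =>
      Real.exp (-x') * (y ^ μ * Real.exp (-y) * cF μ (x' * y)) := by
    filter_upwards [Ioi_mem_nhds hx] with w hw
    exact deriv1 hμ hw hy
  have hd := (cF_hasDerivAt (by linarith : -1 < μ) (x * y)).comp x ((hasDerivAt_id x).mul_const y)
  have hd2 := ((hasDerivAt_neg x).exp.mul (hd.const_mul (y ^ μ * Real.exp (-y))))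
  rw [he.deriv_eq]
  refine hd2.deriv.trans ?_
  simp only [Function.comp, id]
  ring

theorem marcumQ_second_deriv_x_sign (μ x y : ℝ) (hμ : 0 < μ) (hx : 0 < x) (hy : 0 < y) :
    (y - μ - 1 / 2 < x → deriv (deriv (fun x' => marcumQ μ x' y)) x < 0) ∧
      (x < y - μ - 1 → 0 < deriv (deriv (fun x' => marcumQ μ x' y)) x) := by
  have hz : 0 < x * y := mul_pos hx hy
  have pA := cF_pos (by linarith : -1 < μ) hz.le
  have pB := cF_pos (by linarith : -1 < μ + 1) hz.le
  have hU := cF_upper hμ hz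
  have hL := cF_lower hμ hz
  have hc : 0 < Real.exp (-x) * (y ^ μ * Real.exp (-y)) := by positivity
  rw [deriv2 hμ hx hy]
  generalize cF μ (x * y) = A at *
  generalize cF (μ + 1) (x * y) = B at *
  constructor
  · intro h
    refine mul_neg_of_pos_of_neg hc ?_
    by_contra! hn
    have h1 : A * (x * A + (μ + 1/2) * A) ≤ (y * B) * (x * (y * B) + (μ + 1/2) * A) := by
      have : A ≤ y * B := by linarith
      gcongr
    have h2 : 0 < (x + μ + 1/2 - y) * A ^ 2 := mul_pos (by linarith) (by positivity)
    nlinarith [mul_pos hy hU]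
  · intro h
    refine mul_pos hc ?_
    by_contra! hn
    have h1 : (y * B) * (x * (y * B) + (μ + 1) * A) ≤ A * (x * A + (μ + 1) * A) := by
      have : y * B ≤ A := by linarith
      gcongr
    have h2 : 0 < (y - x - μ - 1) * A ^ 2 := mul_pos (by linarith) (by positivity)
    nlinarith [mul_pos hy hL]
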